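/- arXiv:1905.06481 — 2 statements merged into one kernel-verified Lean document; each statement's English description precedes it below -/
import Mathlib

section
/- Let k ≥ 2 be an integer, let α₁, …, α_k > 0 with A₀ := α₁ + ⋯ + α_k, let δ ∈ (0, 1], R > 0, and let χ : ℝ → [0, ∞) be continuous with compact support. Then lim_{ε→0⁺} ∫_{Δ_{k−1}} ( ∫₀^R χ(log((σ₁^{α₁}⋯σ_k^{α_k}·r^{2A₀})/ε)) dr ) · (σ₁⋯σ_{k−1}σ_k)^{δ−1} dσ₁⋯dσ_{k−1} = 0. -/
open MeasureTheory Set Filter Topology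

/-- The affine involution replacing coordinate `j` by the missing simplex coordinate. -/
noncomputable def simplexSwap {n : ℕ} (j : Fin n) (σ : Fin n → ℝ) : Fin n → ℝ :=
  Function.update σ j (1 - ∑ i, σ i)

/-- The linear part of `simplexSwap`. -/
noncomputable def simplexSwapLin {n : ℕ} (j : Fin n) : (Fin n → ℝ) →ₗ[ℝ] (Fin n → ℝ) where
  toFun σ := Function.update σ j (- ∑ i, σ i)
  map_add' x y := by
    ext i
    by_cases h : i = j
    · subst h; simp [Finset.sum_add_distrib]; ring
    · simp [h]
  map_smul' c x := by
    ext i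
    by_cases h : i = j
    · subst h; simp [Finset.mul_sum]
    · simp [h]

lemma simplexSwapLin_sq {n : ℕ} (j : Fin n) :
    (simplexSwapLin j) ∘ₗ (simplexSwapLin j) = LinearMap.id := by
  apply LinearMap.ext
  intro x
  ext i
  by_cases h : i = j
  · subst h
    simp only [simplexSwapLin, LinearMap.comp_apply, LinearMap.coe_mk, AddHom.coe_mk,
      Function.update_self, LinearMap.id_apply]
    rw [Finset.sum_update_of_mem (Finset.mem_univ _)]
    have := Finset.sum_erase_add Finset.univ x (Finset.mem_univ i)
    rw [Finset.sdiff_singleton_eq_erase]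
    linarith
  · simp [simplexSwapLin, h]

lemma simplexSwap_mp {n : ℕ} (j : Fin n) :
    MeasurePreserving (simplexSwap j) volume volume := by
  have hdet : |LinearMap.det (simplexSwapLin j)| = 1 := by
    have h := congrArg LinearMap.det (simplexSwapLin_sq j)
    rw [LinearMap.det_comp, LinearMap.det_id] at h
    rcases mul_self_eq_one_iff.mp h with h | h <;> simp [h]
  have hne : LinearMap.det (simplexSwapLin j) ≠ 0 := by
    intro h; simp [h] at hdet
  have h1 : MeasurePreserving (simplexSwapLin j) volume volume := by
    refine ⟨(LinearMap.continuous_of_finiteDimensional _).measurable, ?_⟩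
    rw [Real.map_linearMap_volume_pi_eq_smul_volume_pi hne, abs_inv, hdet]
    simp
  have h2 := (measurePreserving_add_right (volume : Measure (Fin n → ℝ))
    (Pi.single j 1)).comp h1
  convert h2 using 1
  ext σ i
  by_cases h : i = j
  · subst h; simp [simplexSwap, simplexSwapLin]; ring
  · simp [simplexSwap, simplexSwapLin, h]

/-- One-variable majorant. -/
noncomputable def unitPow (δ : ℝ) : ℝ → ℝ := (Ioc (0:ℝ) 1).indicator (fun x => x ^ (δ - 1))

lemma unitPow_nonneg (δ x : ℝ) : 0 ≤ unitPow δ x := by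
  unfold unitPow
  apply indicator_nonneg
  intro y hy
  exact Real.rpow_nonneg hy.1.le _

lemma integrable_unitPow {δ : ℝ} (hδ : 0 < δ) : Integrable (unitPow δ) := by
  unfold unitPow
  rw [integrable_indicator_iff measurableSet_Ioc]
  have := intervalIntegral.intervalIntegrable_rpow' (a := 0) (b := 1) (r := δ - 1) (by linarith)
  rwa [intervalIntegrable_iff_integrableOn_Ioc_of_le zero_le_one] at this

/-- Product majorant. -/
noncomputable def cubePow (n : ℕ) (δ : ℝ) (σ : Fin n → ℝ) : ℝ := ∏ i, unitPow δ (σ i)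

lemma cubePow_nonneg (n : ℕ) (δ : ℝ) (σ : Fin n → ℝ) : 0 ≤ cubePow n δ σ :=
  Finset.prod_nonneg fun _ _ => unitPow_nonneg _ _

lemma integrable_cubePow (n : ℕ) {δ : ℝ} (hδ : 0 < δ) : Integrable (cubePow n δ) := by
  unfold cubePow
  exact Integrable.fintype_prod (f := fun _ => unitPow δ) (fun _ => integrable_unitPow hδ)

lemma key_bound {n : ℕ} {δ : ℝ} (hδ : δ ≤ 1) (c : ℝ) (hc : 1 / ((n:ℝ) + 1) ≤ c)
    (y : Fin n → ℝ) (hy : ∀ i, y i ∈ Ioc (0:ℝ) 1) :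
    (c * ∏ i, y i) ^ (δ - 1) ≤ (1 / ((n:ℝ) + 1)) ^ (δ - 1) * cubePow n δ y := by
  have h0 : 0 < 1 / ((n:ℝ) + 1) := by positivity
  rw [Real.mul_rpow (h0.le.trans hc) (Finset.prod_nonneg fun i _ => (hy i).1.le),
    ← Real.finsetProd_rpow _ _ (fun i _ => (hy i).1.le)]
  have : cubePow n δ y = ∏ i, y i ^ (δ - 1) := by
    unfold cubePow unitPow
    exact Finset.prod_congr rfl fun i _ => indicator_of_mem (hy i) _
  rw [this]
  refine mul_le_mul_of_nonneg_right (Real.rpow_le_rpow_of_nonpos h0 hc (by linarith)) ?_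
  exact Finset.prod_nonneg fun i _ => Real.rpow_nonneg (hy i).1.le _

/-- The Dirichlet density majorant. -/
noncomputable def dirMaj (n : ℕ) (δ : ℝ) (σ : Fin n → ℝ) : ℝ :=
  (1 / ((n:ℝ) + 1)) ^ (δ - 1) * (cubePow n δ σ + ∑ j, cubePow n δ (simplexSwap j σ))

lemma integrable_dirMaj (n : ℕ) {δ : ℝ} (hδ : 0 < δ) : Integrable (dirMaj n δ) := by
  unfold dirMaj
  refine Integrable.const_mul ((integrable_cubePow n hδ).add ?_) _
  refine integrable_finsetSum _ fun j _ => ?_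
  exact (simplexSwap_mp j).integrable_comp_of_integrable (integrable_cubePow n hδ)

lemma le_dirMaj {n : ℕ} {δ : ℝ} (hδ : δ ≤ 1) (σ : Fin n → ℝ) (hσ : ∀ i, 0 < σ i)
    (hs : 0 < 1 - ∑ i, σ i) :
    ((∏ i, σ i) * (1 - ∑ i, σ i)) ^ (δ - 1) ≤ dirMaj n δ σ := by
  have h0 : 0 < 1 / ((n:ℝ) + 1) := by positivity
  have hle : ∀ i, σ i ≤ 1 := fun i => by
    have := Finset.single_le_sum (f := σ) (fun i _ => (hσ i).le) (Finset.mem_univ i)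
    linarith
  have hsum : 0 ≤ ∑ i, σ i := Finset.sum_nonneg fun i _ => (hσ i).le
  have hC : 0 ≤ (1 / ((n:ℝ) + 1)) ^ (δ - 1) := Real.rpow_nonneg h0.le _
  have hsn : 0 ≤ ∑ j, cubePow n δ (simplexSwap j σ) :=
    Finset.sum_nonneg fun j _ => cubePow_nonneg _ _ _
  unfold dirMaj
  by_cases h : 1 / ((n:ℝ) + 1) ≤ 1 - ∑ i, σ i
  · rw [mul_comm (∏ i, σ i)]
    refine (key_bound hδ _ h σ fun i => ⟨hσ i, hle i⟩).trans ?_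
    gcongr
    linarith
  · obtain ⟨j, hj⟩ : ∃ j, 1 / ((n:ℝ) + 1) ≤ σ j := by
      by_contra! hcon
      have : ∑ i, σ i ≤ ∑ i : Fin n, 1 / ((n:ℝ) + 1) :=
        Finset.sum_le_sum fun i _ => (hcon i).le
      simp only [Finset.sum_const, Finset.card_univ, Fintype.card_fin, nsmul_eq_mul] at this
      have h2 : (n:ℝ) * (1 / ((n:ℝ) + 1)) + 1 / ((n:ℝ) + 1) = 1 := by field_simp
      linarith
    have hp : (∏ i, σ i) * (1 - ∑ i, σ i) = σ j * ∏ i, simplexSwap j σ i := by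
      unfold simplexSwap
      rw [Finset.prod_update_of_mem (Finset.mem_univ _), Finset.sdiff_singleton_eq_erase,
        ← Finset.mul_prod_erase Finset.univ σ (Finset.mem_univ j)]
      ring
    rw [hp]
    refine (key_bound hδ _ hj (simplexSwap j σ) fun i => ?_).trans ?_
    · unfold simplexSwap
      by_cases hij : i = j
      · subst hij; simp only [Function.update_self]; exact ⟨hs, by linarith⟩
      · simp only [Function.update_of_ne hij]; exact ⟨hσ i, hle i⟩
    · gcongr
      have := Finset.single_le_sum (f := fun j => cubePow n δ (simplexSwap j σ))
        (fun j _ => cubePow_nonneg _ _ _) (Finset.mem_univ j)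
      have h3 := cubePow_nonneg n δ σ
      linarith

lemma ae_ne_zero_coord {n : ℕ} (j : Fin n) : ∀ᵐ σ : Fin n → ℝ, σ j ≠ 0 := by
  have := Measure.pi_hyperplane (fun _ : Fin n => (volume : Measure ℝ)) j 0
  rw [ae_iff]
  simpa [volume_pi] using this

lemma ae_interior {n : ℕ} (hn : 0 < n) :
    ∀ᵐ σ : Fin n → ℝ ∂(volume.restrict {σ | (∀ i, 0 ≤ σ i) ∧ ∑ i, σ i ≤ 1}),
      (∀ i, 0 < σ i) ∧ 0 < 1 - ∑ i, σ i := by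
  have hS : MeasurableSet {σ : Fin n → ℝ | (∀ i, 0 ≤ σ i) ∧ ∑ i, σ i ≤ 1} := by
    have h1 : MeasurableSet {σ : Fin n → ℝ | ∀ i, 0 ≤ σ i} := by
      rw [ofPred_forall]
      exact MeasurableSet.iInter fun i => measurableSet_le measurable_const (measurable_pi_apply i)
    have h2 : MeasurableSet {σ : Fin n → ℝ | ∑ i, σ i ≤ 1} :=
      measurableSet_le (by fun_prop) measurable_const
    exact h1.inter h2
  rw [ae_restrict_iff' hS]
  have h1 : ∀ᵐ σ : Fin n → ℝ, ∀ i, σ i ≠ 0 := ae_all_iff.2 ae_ne_zero_coord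
  have h2 := (simplexSwap_mp (⟨0, hn⟩ : Fin n)).quasiMeasurePreserving.ae
    (ae_ne_zero_coord (⟨0, hn⟩ : Fin n))
  filter_upwards [h1, h2] with σ h1 h2 h3
  refine ⟨fun i => lt_of_le_of_ne (h3.1 i) (h1 i).symm, ?_⟩
  simp only [simplexSwap, Function.update_self] at h2
  exact lt_of_le_of_ne (by linarith [h3.2]) h2.symm

lemma density_aux (n : ℕ) (hn : 0 < n) (a : Fin n → ℝ) (b A : ℝ) (δ R : ℝ)
    (hδ : δ ∈ Set.Ioc (0:ℝ) 1)
    (χ : ℝ → ℝ) (hχ_cont : Continuous χ) (hχ_supp : HasCompactSupport χ) :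
    Filter.Tendsto
      (fun ε : ℝ =>
        ∫ σ in {σ : Fin n → ℝ | (∀ i, 0 ≤ σ i) ∧ ∑ i, σ i ≤ 1},
          (∫ r in Set.Ioo (0:ℝ) R,
            χ (Real.log ((∏ i, σ i ^ a i) * (1 - ∑ i, σ i) ^ b * r ^ A / ε))) *
          ((∏ i, σ i) * (1 - ∑ i, σ i)) ^ (δ - 1))
      (nhdsWithin 0 (Set.Ioi (0:ℝ))) (nhds 0) := by
  obtain ⟨M, hM⟩ := hχ_supp.exists_bound_of_continuous hχ_cont
  have hM0 : 0 ≤ M := (norm_nonneg _).trans (hM 0)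
  set S := {σ : Fin n → ℝ | (∀ i, 0 ≤ σ i) ∧ ∑ i, σ i ≤ 1}
  have hint := ae_interior hn
  have hχ0 : ∀ᶠ x in atTop, χ x = 0 := by
    have := hasCompactSupport_iff_eventuallyEq.1 hχ_supp
    rw [Filter.coclosedCompact_eq_cocompact] at this
    exact atTop_le_cocompact this
  have hz : (0:ℝ) = ∫ σ in S, (0:ℝ) := by simp
  refine Eq.subst (motive := fun z => Tendsto _ _ (𝓝 z)) hz.symm ?_
  refine tendsto_integral_filter_of_dominated_convergence
    (fun σ => (M * volume.real (Ioo (0:ℝ) R)) * dirMaj n δ σ) ?_ ?_ ?_ ?_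
  · refine Eventually.of_forall fun ε => ?_
    apply AEStronglyMeasurable.mul
    · have hm : Measurable (fun p : (Fin n → ℝ) × ℝ =>
          χ (Real.log ((∏ i, p.1 i ^ a i) * (1 - ∑ i, p.1 i) ^ b * p.2 ^ A / ε))) := by
        refine hχ_cont.measurable.comp (Real.measurable_log.comp ?_)
        fun_prop
      exact (hm.stronglyMeasurable.integral_prod_right'
        (ν := volume.restrict (Ioo (0:ℝ) R))).aestronglyMeasurable
    · refine Measurable.aestronglyMeasurable ?_
      fun_prop
  · refine Eventually.of_forall fun ε => ?_
    filter_upwards [hint] with σ hσ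
    have hb := le_dirMaj hδ.2 σ hσ.1 hσ.2
    have hp : 0 ≤ ((∏ i, σ i) * (1 - ∑ i, σ i)) ^ (δ - 1) :=
      Real.rpow_nonneg (mul_nonneg (Finset.prod_nonneg fun i _ => (hσ.1 i).le) hσ.2.le) _
    rw [norm_mul, Real.norm_of_nonneg hp]
    refine mul_le_mul ?_ hb hp (by positivity)
    exact norm_setIntegral_le_of_norm_le_const measure_Ioo_lt_top (fun r _ => hM _)
  · exact ((integrable_dirMaj n hδ.1).const_mul _).integrableOn
  · filter_upwards [hint] with σ hσ
    have hc : 0 < (∏ i, σ i ^ a i) * (1 - ∑ i, σ i) ^ b :=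
      mul_pos (Finset.prod_pos fun i _ => Real.rpow_pos_of_pos (hσ.1 i) _)
        (Real.rpow_pos_of_pos hσ.2 _)
    set c := (∏ i, σ i ^ a i) * (1 - ∑ i, σ i) ^ b
    have hin : Tendsto (fun ε : ℝ => ∫ r in Set.Ioo (0:ℝ) R, χ (Real.log (c * r ^ A / ε)))
        (nhdsWithin 0 (Set.Ioi (0:ℝ))) (nhds 0) := by
      have hz : (0:ℝ) = ∫ r in Ioo (0:ℝ) R, (0:ℝ) := by simp
      refine Eq.subst (motive := fun z => Tendsto _ _ (𝓝 z)) hz.symm ?_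
      refine tendsto_integral_filter_of_dominated_convergence (fun _ => M) ?_ ?_ ?_ ?_
      · refine Eventually.of_forall fun ε => Measurable.aestronglyMeasurable ?_
        refine hχ_cont.measurable.comp (Real.measurable_log.comp ?_)
        fun_prop
      · exact Eventually.of_forall fun ε => Eventually.of_forall fun r => hM _
      · exact integrableOn_const measure_Ioo_lt_top.ne
      · rw [ae_restrict_iff' measurableSet_Ioo]
        refine Eventually.of_forall fun r hr => ?_
        have hcr : 0 < c * r ^ A := mul_pos hc (Real.rpow_pos_of_pos hr.1 _)
        have ht : Tendsto (fun ε : ℝ => Real.log (c * r ^ A / ε))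
            (nhdsWithin 0 (Set.Ioi (0:ℝ))) atTop := by
          have h5 : Tendsto (fun ε : ℝ => c * r ^ A / ε) (nhdsWithin 0 (Set.Ioi (0:ℝ))) atTop := by
            simp only [div_eq_mul_inv]
            exact tendsto_inv_nhdsGT_zero.const_mul_atTop hcr
          exact Real.tendsto_log_atTop.comp h5
        exact tendsto_const_nhds.congr' ((ht.eventually hχ0).mono fun _ h => h.symm)
    simpa using hin.mul_const (((∏ i, σ i) * (1 - ∑ i, σ i)) ^ (δ - 1))

/-- with `A₀ := α₁ + ⋯ + α_k`, `δ ∈ (0,1]`, `R > 0`, and continuous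
compactly supported `χ ≥ 0`,
`∫_{Δ_{k−1}} (∫₀^R χ(log(σ₁^{α₁}⋯σ_k^{α_k} r^{2A₀}/ε)) dr) (σ₁⋯σ_{k−1}σ_k)^{δ−1} → 0`
as `ε → 0⁺`. -/
theorem spherical_density_limit_zero (k : ℕ) (hk : 2 ≤ k)
    (α : Fin k → ℝ) (hα : ∀ i, 0 < α i) (δ R : ℝ)
    (hδ : δ ∈ Set.Ioc (0:ℝ) 1) (hR : 0 < R)
    (χ : ℝ → ℝ) (hχ_cont : Continuous χ) (hχ_supp : HasCompactSupport χ)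
    (hχ_nonneg : ∀ x, 0 ≤ χ x) :
    Filter.Tendsto
      (fun ε : ℝ =>
        ∫ σ in {σ : Fin (k - 1) → ℝ | (∀ i, 0 ≤ σ i) ∧ ∑ i, σ i ≤ 1},
          (∫ r in Set.Ioo (0:ℝ) R,
            χ (Real.log ((∏ i, σ i ^ α (Fin.castLE (Nat.sub_le k 1) i)) *
                (1 - ∑ i, σ i) ^ α ⟨k - 1, by omega⟩ *
                r ^ (2 * ∑ j, α j) / ε))) *
          ((∏ i, σ i) * (1 - ∑ i, σ i)) ^ (δ - 1))
      (nhdsWithin 0 (Set.Ioi (0:ℝ))) (nhds 0) := by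
  exact density_aux (k - 1) (by omega) _ _ _ δ R hδ χ hχ_cont hχ_supp
end

section
/- Let k ≥ 1 be an integer and let f : ℂᵏ → [0, ∞] be Lebesgue measurable. Then ∫_{ℂᵏ} f dλ = 2^{−(k−1)} ∫_{[0,2π]^k} ∫_{Δ_{k−1}} ∫₀^∞ f(σ₁^{1/2}·r·e^{iθ₁}, …, σ_k^{1/2}·r·e^{iθ_k}) · r^{2k−1} dr dσ₁⋯dσ_{k−1} dθ₁⋯dθ_k, where σ_k := 1 − σ₁ − ⋯ − σ_{k−1}. (For k = 1, Δ₀ is a single point and the σ-integration is simply evaluation at σ₁ = 1, recovering the usual polar coordinates on ℂ.) -/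
open MeasureTheory Set

/-- The full tuple `(σ₁, …, σ_k)` built from `(σ₁, …, σ_{k−1}) ∈ ℝ^{k−1}` by setting
`σ_k := 1 − σ₁ − ⋯ − σ_{k−1}`. -/
noncomputable def sigmaFull (k : ℕ) (σ : Fin (k - 1) → ℝ) (i : Fin k) : ℝ :=
  if h : (i : ℕ) < k - 1 then σ ⟨i, h⟩ else 1 - ∑ j, σ j

open scoped ENNReal

lemma sc_radial (g : ℝ → ℝ≥0∞) :
    ∫⁻ s in Ioi (0:ℝ), g s = ∫⁻ r in Ioi (0:ℝ), ENNReal.ofReal r * g (r ^ 2 / 2) := by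
  have himg : (fun r : ℝ => r ^ 2 / 2) '' Ioi 0 = Ioi 0 := by
    ext s
    constructor
    · rintro ⟨r, hr, rfl⟩
      have : (0:ℝ) < r := hr
      show (0:ℝ) < r ^ 2 / 2
      positivity
    · intro hs
      have hs' : (0:ℝ) < s := hs
      refine ⟨Real.sqrt (2 * s), Real.sqrt_pos.2 (by positivity), ?_⟩
      show Real.sqrt (2 * s) ^ 2 / 2 = s
      rw [Real.sq_sqrt (by positivity)]
      ring
  have hinj : InjOn (fun r : ℝ => r ^ 2 / 2) (Ioi 0) := by
    intro a ha b hb h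
    have ha' : (0:ℝ) < a := ha
    have hb' : (0:ℝ) < b := hb
    have h' : a ^ 2 / 2 = b ^ 2 / 2 := h
    have : a ^ 2 = b ^ 2 := by linarith
    exact (sq_eq_sq₀ ha'.le hb'.le).1 this
  have key := lintegral_image_eq_lintegral_abs_deriv_mul (s := Ioi (0:ℝ))
    (f := fun r : ℝ => r ^ 2 / 2) (f' := fun r => r) measurableSet_Ioi
    (fun x _ => by
      have := ((hasDerivAt_pow 2 x).div_const 2).hasDerivWithinAt (s := Ioi (0:ℝ))
      simpa using this) hinj g
  rw [himg] at key
  rw [key]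
  refine setLIntegral_congr_fun measurableSet_Ioi (fun r hr => ?_)
  have : (0:ℝ) < r := hr
  simp only [abs_of_pos this]

/-- The polar map with squared radius. -/
noncomputable def scPolar (p : ℝ × ℝ) : ℂ :=
  ((Real.sqrt (2 * p.2) : ℝ) : ℂ) * Complex.exp ((p.1 : ℂ) * Complex.I)

lemma measurable_scPolar : Measurable scPolar := by
  unfold scPolar
  fun_prop

lemma sc_polar_lintegral (f : ℂ → ℝ≥0∞) (hf : Measurable f) :
    ∫⁻ z, f z = ∫⁻ θ in Icc 0 (2 * Real.pi), ∫⁻ s in Ici (0:ℝ), f (scPolar (θ, s)) := by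
  have h1 : ∫⁻ z, f z = ∫⁻ z, f (-z) := (lintegral_neg_eq_self (μ := volume) f).symm
  rw [h1, ← Complex.lintegral_comp_polarCoord_symm, polarCoord_target,
    Measure.volume_eq_prod, ← Measure.prod_restrict, lintegral_prod_symm']
  swap
  · simp only [Complex.polarCoord_symm_apply, smul_eq_mul]
    fun_prop
  have h2 : ∀ θ : ℝ, ∫⁻ s in Ici (0:ℝ), f (scPolar (θ, s)) =
      ∫⁻ r in Ioi (0:ℝ), ENNReal.ofReal r * f ((r : ℂ) * Complex.exp ((θ : ℂ) * Complex.I)) := by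
    intro θ
    rw [setLIntegral_congr Ioi_ae_eq_Ici.symm, sc_radial]
    refine setLIntegral_congr_fun measurableSet_Ioi (fun r hr => ?_)
    have : (0:ℝ) < r := hr
    simp only [scPolar]
    rw [show 2 * (r ^ 2 / 2) = r ^ 2 by ring, Real.sqrt_sq this.le]
  simp only [h2]
  rw [setLIntegral_congr Ioo_ae_eq_Icc.symm, ← lintegral_indicator measurableSet_Ioo,
    ← lintegral_indicator measurableSet_Ioo]
  rw [← lintegral_add_right_eq_self ((Ioo 0 (2 * Real.pi)).indicator _) Real.pi]
  refine lintegral_congr fun θ => ?_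
  by_cases h : θ ∈ Ioo (-Real.pi) Real.pi
  · rw [indicator_of_mem h, indicator_of_mem
      (show θ + Real.pi ∈ Ioo 0 (2 * Real.pi) from ⟨by linarith [h.1], by linarith [h.2]⟩)]
    refine lintegral_congr fun r => ?_
    rw [smul_eq_mul, Complex.polarCoord_symm_apply]
    congr 2
    push_cast
    rw [add_mul, Complex.exp_add, Complex.exp_pi_mul_I, Complex.exp_mul_I]
    ring
  · rw [indicator_of_notMem h, indicator_of_notMem]
    rintro ⟨h3, h4⟩
    exact h ⟨by linarith, by linarith⟩

lemma sc_polar_mp : MeasurePreserving scPolar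
    ((volume.restrict (Icc 0 (2 * Real.pi))).prod (volume.restrict (Ici (0:ℝ)))) volume := by
  refine ⟨measurable_scPolar, ?_⟩
  refine Measure.ext_of_lintegral _ fun f hf => ?_
  rw [lintegral_map hf measurable_scPolar, sc_polar_lintegral f hf, lintegral_prod]
  exact (hf.comp measurable_scPolar).aemeasurable

lemma sc_pi (k : ℕ) (f : (Fin k → ℂ) → ℝ≥0∞) (hf : Measurable f) :
    ∫⁻ z, f z = ∫⁻ θ in Set.univ.pi fun _ : Fin k => Icc (0:ℝ) (2 * Real.pi),
      ∫⁻ s in Set.univ.pi fun _ : Fin k => Ici (0:ℝ), f (fun i => scPolar (θ i, s i)) := by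
  have h1 := measurePreserving_pi (fun _ : Fin k =>
    (volume.restrict (Icc 0 (2 * Real.pi))).prod (volume.restrict (Ici (0:ℝ))))
    (fun _ => (volume : Measure ℂ)) (fun _ => sc_polar_mp)
  have h2 := (measurePreserving_arrowProdEquivProdArrow ℝ ℝ (Fin k)
    (fun _ => volume.restrict (Icc 0 (2 * Real.pi))) (fun _ => volume.restrict (Ici (0:ℝ)))).symm
  have h3 := h1.comp h2
  rw [volume_pi, ← h3.lintegral_comp hf, volume_pi, Measure.restrict_pi_pi,
    Measure.restrict_pi_pi, lintegral_prod]
  · rfl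
  · exact (hf.comp h3.measurable).aemeasurable

lemma sc_scale (n : ℕ) (t : ℝ) (ht : 0 < t) (g : (Fin n → ℝ) → ℝ≥0∞) (hg : Measurable g) :
    ∫⁻ x, g x = ENNReal.ofReal (t ^ n) * ∫⁻ x, g (t • x) := by
  have h := Measure.map_addHaar_smul (volume : Measure (Fin n → ℝ)) ht.ne'
  have h2 : ∫⁻ x, g (t • x) = ∫⁻ x, g x ∂(Measure.map (t • ·) volume) :=
    (lintegral_map hg (measurable_const_smul t)).symm
  rw [h2, h, lintegral_smul_measure, smul_eq_mul, ← mul_assoc, ← ENNReal.ofReal_mul (by positivity)]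
  rw [Module.finrank_fin_fun, abs_of_pos (by positivity), mul_inv_cancel₀ (by positivity)]
  simp

lemma measurable_sigmaFull (k : ℕ) : Measurable (fun σ => sigmaFull k σ) := by
  refine measurable_pi_iff.2 fun i => ?_
  unfold sigmaFull
  split_ifs <;> fun_prop

lemma sc_simplex (n : ℕ) (h : (Fin (n+1) → ℝ) → ℝ≥0∞) (hh : Measurable h) :
    ∫⁻ s in Set.univ.pi fun _ : Fin (n+1) => Ici (0:ℝ), h s =
      ENNReal.ofReal ((2:ℝ) ^ (-(((n+1:ℕ) : ℝ) - 1))) *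
      ∫⁻ σ in {σ : Fin n → ℝ | (∀ i, 0 ≤ σ i) ∧ ∑ i, σ i ≤ 1},
        ∫⁻ r in Ioi (0:ℝ), h (fun i => sigmaFull (n+1) σ i * (r ^ 2 / 2)) *
          ENNReal.ofReal (r ^ (2 * (n+1) - 1)) := by
  have hms : MeasurableSet (Set.univ.pi fun _ : Fin (n+1) => Ici (0:ℝ)) :=
    MeasurableSet.univ_pi fun _ => measurableSet_Ici
  set H := (Set.univ.pi fun _ : Fin (n+1) => Ici (0:ℝ)).indicator h with hH
  have hHm : Measurable H := hh.indicator hms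
  have hsm : MeasurableSet {σ : Fin n → ℝ | (∀ i, 0 ≤ σ i) ∧ ∑ i, σ i ≤ 1} := by
    refine MeasurableSet.inter ?_ ?_
    · show MeasurableSet {σ : Fin n → ℝ | ∀ i, 0 ≤ σ i}
      rw [Set.ofPred_forall]
      exact MeasurableSet.iInter fun i => measurableSet_le measurable_const (measurable_pi_apply i)
    · exact measurableSet_le (f := fun σ : Fin n → ℝ => ∑ i, σ i) (by fun_prop) measurable_const
  -- the point with first coordinates `x` and total `t`
  let P : ℝ → (Fin n → ℝ) → Fin (n+1) → ℝ := fun t x => Fin.snoc (α := fun _ => ℝ) x (t - ∑ j, x j)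
  have hPm : Measurable (fun q : ℝ × (Fin n → ℝ) => P q.1 q.2) := by
    refine measurable_pi_iff.2 fun i => ?_
    refine Fin.lastCases ?_ (fun i => ?_) i
    · simp only [P, Fin.snoc_last]; fun_prop
    · simp only [P, Fin.snoc_castSucc]; fun_prop
  have hPs : ∀ t σ, P t (t • σ) = fun i => sigmaFull (n+1) σ i * t := by
    intro t σ
    funext i
    refine Fin.lastCases ?_ (fun i => ?_) i
    · simp [P, sigmaFull, ← Finset.mul_sum]; ring
    · simp [P, sigmaFull]; ring
  have e1 : ∫⁻ s, H s = ∫⁻ x : Fin n → ℝ, ∫⁻ t : ℝ, H (P t x) := by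
    rw [← (volume_preserving_piFinSuccAbove (fun _ : Fin (n+1) => ℝ) (Fin.last n)).symm.lintegral_comp
      hHm, Measure.volume_eq_prod, lintegral_prod_symm']
    · refine lintegral_congr fun x => ?_
      rw [← lintegral_sub_right_eq_self _ (∑ j, x j)]
      refine lintegral_congr fun t => ?_
      congr 1
      simp only [MeasurableEquiv.piFinSuccAbove_symm_apply, P]
      simp [Fin.insertNthEquiv, Fin.insertNth_last']
    · exact hHm.comp (MeasurableEquiv.measurable _)
  have hmem : ∀ t σ, 0 < t → H (P t (t • σ)) =
      {σ : Fin n → ℝ | (∀ i, 0 ≤ σ i) ∧ ∑ i, σ i ≤ 1}.indicator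
        (fun σ => h (fun i => sigmaFull (n+1) σ i * t)) σ := by
    intro t σ ht
    have hiff : P t (t • σ) ∈ (Set.univ.pi fun _ : Fin (n+1) => Ici (0:ℝ)) ↔
        σ ∈ {σ : Fin n → ℝ | (∀ i, 0 ≤ σ i) ∧ ∑ i, σ i ≤ 1} := by
      rw [hPs]
      simp only [Set.mem_univ_pi, mem_Ici, mem_ofPred_eq]
      rw [Fin.forall_fin_succ']
      refine and_congr (forall_congr' fun i => ?_) ?_
      · rw [mul_nonneg_iff_of_pos_right ht]
        simp [sigmaFull]
      · rw [mul_nonneg_iff_of_pos_right ht]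
        simp [sigmaFull]
    by_cases hσ : σ ∈ {σ : Fin n → ℝ | (∀ i, 0 ≤ σ i) ∧ ∑ i, σ i ≤ 1}
    · rw [indicator_of_mem hσ, hH, indicator_of_mem (hiff.2 hσ), hPs]
    · rw [indicator_of_notMem hσ, hH, indicator_of_notMem (fun h' => hσ (hiff.1 h'))]
  have hneg : ∀ t x, t < 0 → H (P t x) = 0 := by
    intro t x ht
    refine indicator_of_notMem (fun h' => ?_) _
    simp only [Set.mem_univ_pi, mem_Ici] at h'
    rw [Fin.forall_fin_succ'] at h'
    have h1 : 0 ≤ ∑ j, x j := Finset.sum_nonneg fun j _ => by simpa [P] using h'.1 j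
    have h2 : 0 ≤ t - ∑ j, x j := by simpa [P] using h'.2
    linarith
  have hm3 : Measurable (fun q : (Fin n → ℝ) × ℝ => h (fun i => sigmaFull (n+1) q.1 i * q.2)) := by
    refine hh.comp (measurable_pi_iff.2 fun i => ?_)
    exact ((measurable_pi_apply i).comp ((measurable_sigmaFull (n+1)).comp measurable_fst)).mul
      measurable_snd
  have hm4 : Measurable (fun q : (Fin n → ℝ) × ℝ =>
      h (fun i => sigmaFull (n+1) q.1 i * (q.2 ^ 2 / 2)) *
          ENNReal.ofReal (q.2 ^ (2 * (n+1) - 1))) := by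
    refine Measurable.mul ?_ (by fun_prop)
    have hq : Measurable (fun q : (Fin n → ℝ) × ℝ => (q.1, q.2 ^ 2 / 2)) := by fun_prop
    exact hm3.comp hq
  rw [← lintegral_indicator hms, ← hH, e1, lintegral_lintegral_swap]
  swap
  · exact (hHm.comp (hPm.comp measurable_swap)).aemeasurable
  have e2 : ∫⁻ t : ℝ, ∫⁻ x : Fin n → ℝ, H (P t x) =
      ∫⁻ t in Ioi (0:ℝ), ∫⁻ x : Fin n → ℝ, H (P t x) := by
    rw [setLIntegral_congr Ioi_ae_eq_Ici, ← lintegral_indicator measurableSet_Ici]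
    refine lintegral_congr fun t => ?_
    by_cases ht : t ∈ Ici (0:ℝ)
    · rw [indicator_of_mem ht]
    · rw [indicator_of_notMem ht]
      simp [hneg t _ (not_le.1 ht)]
  have e3 : ∫⁻ t in Ioi (0:ℝ), ∫⁻ x : Fin n → ℝ, H (P t x) =
      ∫⁻ t in Ioi (0:ℝ), ENNReal.ofReal (t ^ n) *
        ∫⁻ σ in {σ : Fin n → ℝ | (∀ i, 0 ≤ σ i) ∧ ∑ i, σ i ≤ 1},
          h (fun i => sigmaFull (n+1) σ i * t) := by
    refine setLIntegral_congr_fun measurableSet_Ioi (fun t ht => ?_)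
    have ht' : (0:ℝ) < t := ht
    rw [sc_scale n t ht' (fun x => H (P t x)) (hHm.comp (hPm.comp measurable_prodMk_left)),
      ← lintegral_indicator hsm]
    congr 1
    exact lintegral_congr fun σ => hmem t σ ht'
  rw [e2, e3, sc_radial, lintegral_lintegral_swap hm4.aemeasurable,
    ← lintegral_const_mul]
  swap
  · exact (hm4.comp measurable_swap).lintegral_prod_right'
  refine setLIntegral_congr_fun measurableSet_Ioi (fun r hr => ?_)
  have hr' : (0:ℝ) < r := hr
  rw [lintegral_mul_const, ← mul_assoc, ← ENNReal.ofReal_mul hr'.le, mul_comm (lintegral _ _),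
    ← mul_assoc, ← ENNReal.ofReal_mul (by positivity)]
  · congr 2
    rw [show 2 * (n+1) - 1 = 2 * n + 1 by omega]
    push_cast
    rw [add_sub_cancel_right, Real.rpow_neg (by norm_num), Real.rpow_natCast, div_pow]
    field_simp
    ring
  · exact hm3.comp (measurable_id.prodMk measurable_const)

/-- spherical coordinates on `ℂᵏ`: for measurable `f : ℂᵏ → [0, ∞]`,
`∫_{ℂᵏ} f = 2^{−(k−1)} ∫_{[0,2π]^k} ∫_{Δ_{k−1}} ∫₀^∞
  f(σ₁^{1/2} r e^{iθ₁}, …, σ_k^{1/2} r e^{iθ_k}) r^{2k−1} dr dσ dθ`. -/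
theorem spherical_coordinates (k : ℕ) (hk : 1 ≤ k)
    (f : (Fin k → ℂ) → ENNReal) (hf : Measurable f) :
    (∫⁻ z : Fin k → ℂ, f z) =
      ENNReal.ofReal ((2:ℝ) ^ (-((k : ℝ) - 1))) *
        ∫⁻ θ in Set.univ.pi fun _ : Fin k => Set.Icc (0:ℝ) (2 * Real.pi),
          ∫⁻ σ in {σ : Fin (k - 1) → ℝ | (∀ i, 0 ≤ σ i) ∧ ∑ i, σ i ≤ 1},
            ∫⁻ r in Set.Ioi (0:ℝ),
              f (fun i =>
                  ((Real.sqrt (sigmaFull k σ i) * r : ℝ) : ℂ) *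
                    Complex.exp ((θ i : ℂ) * Complex.I)) *
                ENNReal.ofReal (r ^ (2 * k - 1)) := by
  obtain ⟨n, rfl⟩ : ∃ n, k = n + 1 := ⟨k - 1, by omega⟩
  rw [sc_pi _ f hf, ← lintegral_const_mul' _ _ ENNReal.ofReal_ne_top]
  refine lintegral_congr fun θ => ?_
  have hm : Measurable (fun s : Fin (n+1) → ℝ => f (fun i => scPolar (θ i, s i))) := by
    refine hf.comp (measurable_pi_iff.2 fun i => ?_)
    exact measurable_scPolar.comp (measurable_const.prodMk (measurable_pi_apply i))
  rw [sc_simplex n _ hm]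
  congr 1
  refine lintegral_congr fun σ => ?_
  refine setLIntegral_congr_fun measurableSet_Ioi (fun r hr => ?_)
  have hr' : (0:ℝ) < r := hr
  simp only [scPolar]
  congr 3
  funext i
  rw [show 2 * (sigmaFull (n+1) σ i * (r ^ 2 / 2)) = sigmaFull (n+1) σ i * r ^ 2 by ring,
    Real.sqrt_mul' _ (by positivity), Real.sqrt_sq hr'.le]
end
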